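/- Let K be an algebraically closed field, let m ≥ 1 be a natural number, and let T ⊆ A(m) and Q ⊆ A(m) ⊗ A(m) be K-linear subspaces such that dim_K T + 4·dim_K Q ≤ dim_K A(m) − 2 (note dim_K A(m) = 2^m). Then there exists a K-linear subspace F ⊆ A(m) such that T ⊆ F, Q ⊆ F ⊗ A(m) + A(m) ⊗ F, and dim_K A(m) = 1 + dim_K F. -/

import Mathlib

open TensorProduct

noncomputable section

/-- The free associative unital `K`-algebra on two generators `x, y`. -/
abbrev FA (K : Type) [Field K] : Type := FreeAlgebra K (Fin 2)

/-- `gp K n` is `A(n)`, the span of the words of length `n` in the two generators. -/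
def gp (K : Type) [Field K] (n : ℕ) : Submodule K (FA K) :=
  Submodule.span K {a : FA K | ∃ w : List (Fin 2), w.length = n ∧ a = (w.map (FreeAlgebra.ι K)).prod}

/-- The canonical image of `U ⊗[K] V` inside `A ⊗[K] A`. -/
def tp (K : Type) [Field K] (U V : Submodule K (FA K)) : Submodule K (FA K ⊗[K] FA K) :=
  Submodule.map₂ (TensorProduct.mk K (FA K) (FA K)) U V

/-- The substitution killing the variables in `s` and fixing the others. -/
def killVars {ι : Type*} [DecidableEq ι] (K : Type*) [CommRing K] (s : Finset ι) :
    MvPolynomial ι K →ₐ[K] MvPolynomial ι K :=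
  MvPolynomial.aeval fun i => if i ∈ s then 0 else MvPolynomial.X i

theorem ker_killVars_mono {ι K : Type*} [DecidableEq ι] [CommRing K] {s t : Finset ι}
    (h : s ⊆ t) : RingHom.ker (killVars K s) ≤ RingHom.ker (killVars K t) := by
  have hcomp : (killVars K t).comp (killVars K s) = killVars K t := by
    ext1 i
    by_cases hs : i ∈ s
    · simp [killVars, hs, h hs]
    · simp [killVars, hs]
  intro p hp
  rw [RingHom.mem_ker] at hp ⊢
  rw [← hcomp, AlgHom.comp_apply, hp, map_zero]

theorem card_le_height_ker_killVars {ι K : Type*} [Finite ι] [DecidableEq ι] [Field K]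
    (s : Finset ι) : (s.card : ℕ∞) ≤ (RingHom.ker (killVars K s)).height := by
  induction s using Finset.induction_on with
  | empty => simp
  | insert a s ha ih =>
    have hs : (RingHom.ker (killVars K s)).IsPrime := RingHom.ker_isPrime _
    have ht : (RingHom.ker (killVars K (insert a s))).IsPrime := RingHom.ker_isPrime _
    have hlt : RingHom.ker (killVars K s) < RingHom.ker (killVars K (insert a s)) := by
      refine lt_of_le_not_ge (ker_killVars_mono (Finset.subset_insert a s)) fun hle => ?_
      have hX : MvPolynomial.X a ∈ RingHom.ker (killVars K s) := hle (by simp [killVars])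
      simp [killVars, ha] at hX
    rw [Finset.card_insert_of_notMem ha, Nat.cast_succ]
    exact (add_le_add_left ih 1).trans
      (Order.add_one_le_of_lt (Ideal.height_strict_mono_of_isPrime_of_isPrime hlt))

theorem card_le_height_vanishingIdeal_zero (ι K : Type*) [Fintype ι] [Field K] :
    (Fintype.card ι : ℕ∞) ≤
      (MvPolynomial.vanishingIdeal K {(0 : ι → K)} : Ideal (MvPolynomial ι K)).height := by
  classical
  refine (card_le_height_ker_killVars (K := K) Finset.univ).trans (Ideal.height_mono fun p hp => ?_)
  have hcomp : (MvPolynomial.aeval (0 : ι → K)).comp (killVars K Finset.univ) =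
      (MvPolynomial.aeval (0 : ι → K) : MvPolynomial ι K →ₐ[K] K) := by
    ext1 i
    simp [killVars]
  rw [RingHom.mem_ker] at hp
  rw [MvPolynomial.mem_vanishingIdeal_singleton_iff, ← hcomp, AlgHom.comp_apply, hp, map_zero]

/-- Over an algebraically closed field, fewer polynomials than variables, all vanishing at the
origin, have a further common zero. -/
theorem exists_ne_zero_common_zero {ι κ K : Type*} [Fintype ι] [Fintype κ] [Field K]
    [IsAlgClosed K] (P : κ → MvPolynomial ι K) (hP : ∀ k, MvPolynomial.aeval (0 : ι → K) (P k) = 0)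
    (hcard : Fintype.card κ < Fintype.card ι) :
    ∃ c : ι → K, c ≠ 0 ∧ ∀ k, MvPolynomial.aeval c (P k) = 0 := by
  by_contra! hc
  set I := Ideal.span (Set.range P)
  set M : Ideal (MvPolynomial ι K) := MvPolynomial.vanishingIdeal K {(0 : ι → K)}
  have hzero : MvPolynomial.zeroLocus K I = {(0 : ι → K)} := by
    rw [MvPolynomial.zeroLocus_span]
    ext c
    simp only [Set.forall_mem_range, Set.mem_ofPred_eq, Set.mem_singleton_iff]
    refine ⟨fun h => ?_, fun h => h ▸ hP⟩
    by_contra hne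
    obtain ⟨k, hk⟩ := hc c hne
    exact hk (h k)
  have hrad : M = I.radical := by
    rw [← MvPolynomial.vanishingIdeal_zeroLocus_eq_radical (K := K), hzero]
  have hM : M.IsPrime := inferInstance
  have hmin : M ∈ I.minimalPrimes :=
    ⟨⟨hM, hrad ▸ Ideal.le_radical⟩, fun J hJ _ => hrad ▸ hJ.1.radical_le_iff.mpr hJ.2⟩
  have h₁ := Ideal.height_le_card_of_mem_minimalPrimes_span (Set.finite_range P) hmin
  have h₂ : (Set.range P).ncard ≤ Fintype.card κ := by
    rw [← Set.image_univ, ← Nat.card_eq_fintype_card, ← Set.ncard_univ]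
    exact Set.ncard_image_le Set.finite_univ
  have h₃ := (card_le_height_vanishingIdeal_zero ι K).trans h₁
  exact absurd (Nat.cast_le.mp h₃) (by omega)

/-- The linear form `f ⊗ g` on `V ⊗ V`. -/
def tensorForm {K V : Type*} [Field K] [AddCommGroup V] [Module K V] (f g : V →ₗ[K] K) :
    V ⊗[K] V →ₗ[K] K :=
  LinearMap.mul' K K ∘ₗ TensorProduct.map f g

@[simp]
theorem tensorForm_tmul {K V : Type*} [Field K] [AddCommGroup V] [Module K V]
    (f g : V →ₗ[K] K) (a b : V) : tensorForm f g (a ⊗ₜ b) = f a * g b := by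
  simp [tensorForm]

theorem tensorForm_sum_smul {ι K V : Type*} [Fintype ι] [Field K] [AddCommGroup V] [Module K V]
    (ψ : ι → V →ₗ[K] K) (c : ι → K) (q : V ⊗[K] V) :
    tensorForm (∑ i, c i • ψ i) (∑ i, c i • ψ i) q =
      ∑ i, ∑ j, c i * c j * tensorForm (ψ i) (ψ j) q := by
  induction q using TensorProduct.induction_on with
  | zero => simp
  | tmul a b =>
    simp only [tensorForm_tmul, LinearMap.sum_apply, LinearMap.smul_apply, smul_eq_mul,
      Finset.sum_mul_sum]
    exact Finset.sum_congr rfl fun i _ => Finset.sum_congr rfl fun j _ => by ring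
  | add p q hp hq => simp only [map_add, hp, hq, mul_add, Finset.sum_add_distrib]

theorem exists_form_tensorForm_eq_zero {K A : Type*} [Field K] [IsAlgClosed K] [AddCommGroup A]
    [Module K A] (V T : Submodule K A) (Q : Submodule K (A ⊗[K] A)) [FiniteDimensional K V]
    [FiniteDimensional K Q] (hT : T ≤ V)
    (hdim : Module.finrank K T + Module.finrank K Q < Module.finrank K V) :
    ∃ f : A →ₗ[K] K, (∀ a ∈ T, f a = 0) ∧ (∃ v ∈ V, f v ≠ 0) ∧ ∀ q ∈ Q, tensorForm f f q = 0 := by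
  set S : Submodule K V := T.comap V.subtype
  have hS : Module.finrank K S = Module.finrank K T :=
    (Submodule.comapSubtypeEquivOfLe hT).finrank_eq
  have hquot := S.finrank_quotient_add_finrank
  let b := Module.finBasis K (V ⧸ S)
  let e := Module.finBasis K Q
  choose ψ hψ using fun i => (b.coord i ∘ₗ S.mkQ).exists_extend
  have hψV (i) (v : V) : ψ i v = b.repr (S.mkQ v) i := LinearMap.congr_fun (hψ i) v
  obtain ⟨c, hc, hzero⟩ := exists_ne_zero_common_zero
    (fun k => ∑ i, ∑ j, MvPolynomial.X i * MvPolynomial.X j *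
      MvPolynomial.C (tensorForm (ψ i) (ψ j) (e k : A ⊗[K] A)))
    (fun k => by simp) (by simp only [Fintype.card_fin]; omega)
  refine ⟨∑ i, c i • ψ i, fun a ha => ?_, ?_, fun q hq => ?_⟩
  · have hmk : S.mkQ ⟨a, hT ha⟩ = 0 := by simpa [S] using ha
    have hψa (i) : ψ i a = 0 := by simpa [hmk] using hψV i ⟨a, hT ha⟩
    simp [hψa]
  · obtain ⟨i, hi⟩ := Function.ne_iff.mp hc
    obtain ⟨v, hv⟩ := S.mkQ_surjective (b i)
    refine ⟨v, v.2, ?_⟩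
    simpa [hψV, hv, Finsupp.single_apply, -Submodule.mkQ_apply] using hi
  · have hker : tensorForm (∑ i, c i • ψ i) (∑ i, c i • ψ i) ∘ₗ Q.subtype = 0 := by
      refine e.ext fun k => ?_
      simpa [tensorForm_sum_smul] using hzero k
    exact LinearMap.congr_fun hker ⟨q, hq⟩

theorem mem_tp_sup_tp_of_tensorForm_eq_zero {K : Type} [Field K] {V : Submodule K (FA K)}
    {f : FA K →ₗ[K] K} {v : FA K} (hv : v ∈ V) (hfv : f v = 1) {q : FA K ⊗[K] FA K}
    (hq : q ∈ tp K V V) (hfq : tensorForm f f q = 0) :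
    q ∈ tp K (V ⊓ LinearMap.ker f) V ⊔ tp K V (V ⊓ LinearMap.ker f) := by
  set U := tp K (V ⊓ LinearMap.ker f) V ⊔ tp K V (V ⊓ LinearMap.ker f)
  have hsub (a) (ha : a ∈ V) : a - f a • v ∈ V ⊓ LinearMap.ker f :=
    ⟨V.sub_mem ha (V.smul_mem _ hv), by simp [hfv]⟩
  have hle : tp K V V ≤
      U.comap (LinearMap.id - (tensorForm f f).smulRight (v ⊗ₜ[K] v)) := by
    refine Submodule.map₂_le.mpr fun a ha b hb => ?_
    have hsplit : a ⊗ₜ[K] b - (f a * f b) • v ⊗ₜ[K] v =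
        (a - f a • v) ⊗ₜ[K] b + (f a • v) ⊗ₜ[K] (b - f b • v) := by
      simp only [sub_tmul, tmul_sub, tmul_smul, ← smul_tmul', smul_smul]
      rw [mul_comm (f b)]
      abel
    simp only [Submodule.mem_comap, mk_apply, LinearMap.sub_apply, LinearMap.id_apply,
      LinearMap.smulRight_apply, tensorForm_tmul, hsplit]
    exact U.add_mem
      (Submodule.mem_sup_left (Submodule.apply_mem_map₂ _ (hsub a ha) hb))
      (Submodule.mem_sup_right (Submodule.apply_mem_map₂ _ (V.smul_mem _ hv) (hsub b hb)))
  simpa [hfq] using hle hq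

theorem finrank_eq_one_add_finrank_inf_ker {K A : Type*} [Field K] [AddCommGroup A] [Module K A]
    (V : Submodule K A) [FiniteDimensional K V] {f : A →ₗ[K] K} {v : A} (hv : v ∈ V)
    (hfv : f v ≠ 0) :
    Module.finrank K V = 1 + Module.finrank K (V ⊓ LinearMap.ker f : Submodule K A) := by
  have hne : f.domRestrict V ≠ 0 := fun h => hfv (LinearMap.congr_fun h ⟨v, hv⟩)
  have hker : (LinearMap.ker (f.domRestrict V)).map V.subtype = V ⊓ LinearMap.ker f := by
    rw [LinearMap.ker_domRestrict, Submodule.map_comap_subtype]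
  rw [← hker, Submodule.finrank_map_subtype_eq, add_comm]
  exact (Module.Dual.finrank_ker_add_one_of_ne_zero hne).symm

instance finiteDimensional_gp (K : Type) [Field K] (m : ℕ) : FiniteDimensional K (gp K m) := by
  refine FiniteDimensional.span_of_finite K (((List.finite_length_eq (Fin 2) m).image
    fun w => (w.map (FreeAlgebra.ι K)).prod).subset ?_)
  rintro _ ⟨w, hw, rfl⟩
  exact ⟨w, hw, rfl⟩

theorem gp_ne_bot (K : Type) [Field K] (m : ℕ) : gp K m ≠ ⊥ := by
  intro h
  have hmem : FreeAlgebra.ι K (0 : Fin 2) ^ m ∈ gp K m :=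
    Submodule.subset_span ⟨List.replicate m 0, by simp, by simp⟩
  rw [h, Submodule.mem_bot] at hmem
  simpa using congrArg (FreeAlgebra.lift K fun _ : Fin 2 => (1 : K)) hmem

/-- Over an algebraically closed field, if `T ⊆ A(m)` and `Q ⊆ A(m) ⊗ A(m)` with
`dim T + 4 dim Q ≤ dim A(m) − 2`, then there is a codimension-one subspace
`F ⊆ A(m)` with `T ⊆ F` and `Q ⊆ F ⊗ A(m) + A(m) ⊗ F`. -/
theorem statement3 (K : Type) [Field K] [IsAlgClosed K] (m : ℕ) (hm : 1 ≤ m)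
    (T : Submodule K (FA K)) (hT : T ≤ gp K m)
    (Q : Submodule K (FA K ⊗[K] FA K)) (hQ : Q ≤ tp K (gp K m) (gp K m))
    (hdim : Module.finrank K T + 4 * Module.finrank K Q ≤ Module.finrank K (gp K m) - 2) :
    ∃ F : Submodule K (FA K), F ≤ gp K m ∧ T ≤ F ∧
      Q ≤ tp K F (gp K m) ⊔ tp K (gp K m) F ∧
      Module.finrank K (gp K m) = 1 + Module.finrank K F := by
  have hgp : 0 < Module.finrank K (gp K m) :=
    Module.finrank_pos_iff.mpr (Submodule.nontrivial_iff_ne_bot.mpr (gp_ne_bot K m))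
  have hfg : (tp K (gp K m) (gp K m)).FG :=
    Submodule.FG.map₂ _ (Module.Finite.iff_fg.mp inferInstance)
      (Module.Finite.iff_fg.mp inferInstance)
  have := Module.Finite.iff_fg.mpr hfg
  have := Submodule.finiteDimensional_of_le hQ
  obtain ⟨f, hfT, ⟨v, hv, hfv⟩, hfQ⟩ :=
    exists_form_tensorForm_eq_zero (gp K m) T Q hT (by omega)
  refine ⟨gp K m ⊓ LinearMap.ker f, inf_le_left, fun a ha => ⟨hT ha, hfT a ha⟩, fun q hq => ?_,
    finrank_eq_one_add_finrank_inf_ker _ hv hfv⟩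
  exact mem_tp_sup_tp_of_tensorForm_eq_zero (v := (f v)⁻¹ • v) (Submodule.smul_mem _ _ hv)
    (by simp [hfv]) (hQ hq) (hfQ q hq)
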